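/- The map P : m → m is ℂ-differentiable at every point, and for every Z ∈ m its Fréchet derivative at Z is the ℂ-linear map B ↦ S_{JZ}(E_Z(B)). -/

import Mathlib

noncomputable section

variable {L : Type*} [NormedAddCommGroup L] [NormedSpace ℂ L] [FiniteDimensional ℂ L]

/-- The adjoint operator ad_Z = ⁅Z, ·⁆, as a continuous ℂ-linear endomorphism of L, where the
Lie bracket of L is given by the ℂ-bilinear map bra. -/
def adC (bra : L →ₗ[ℂ] L →ₗ[ℂ] L) (Z : L) : L →L[ℂ] L :=
  LinearMap.toContinuousLinearMap (bra Z)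

/-- exp T = Σ_{n ≥ 0} Tⁿ/n!, the exponential in the Banach algebra of continuous ℂ-linear
endomorphisms of L. -/
def expOp (T : L →L[ℂ] L) : L →L[ℂ] L :=
  ∑' n : ℕ, ((n.factorial : ℂ)⁻¹) • T ^ n

/-- E_Z = Σ_{n ≥ 0} ad_Z^{2n}/(2n+1)!. -/
def Eop (bra : L →ₗ[ℂ] L →ₗ[ℂ] L) (Z : L) : L →L[ℂ] L :=
  ∑' n : ℕ, (((2 * n + 1).factorial : ℂ)⁻¹) • adC bra Z ^ (2 * n)

/-- F_Z = Σ_{n ≥ 1} ad_Z^{2n-1}/(2n)!. -/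
def Fop (bra : L →ₗ[ℂ] L →ₗ[ℂ] L) (Z : L) : L →L[ℂ] L :=
  ∑' n : ℕ, (((2 * n + 2).factorial : ℂ)⁻¹) • adC bra Z ^ (2 * n + 1)

/-- S_Z = Σ_{n ≥ 0} ad_Z^{2n}/(2n)!. -/
def Sop (bra : L →ₗ[ℂ] L →ₗ[ℂ] L) (Z : L) : L →L[ℂ] L :=
  ∑' n : ℕ, (((2 * n).factorial : ℂ)⁻¹) • adC bra Z ^ (2 * n)

/-- A commutation formula in a ring: if `H (k + 1) = ⁅A, H k⁆` for all `k`, then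
`∑ A^(n-i) H₀ A^i` can be rewritten with all powers of `A` on the left. -/
lemma sum_pow_mul_mul_pow_eq {R : Type*} [Ring R] (A : R) (n : ℕ) (H : ℕ → R)
    (hH : ∀ k, H (k + 1) = A * H k - H k * A) :
    ∑ i ∈ Finset.range (n + 1), A ^ (n - i) * H 0 * A ^ i =
      ∑ k ∈ Finset.range (n + 1),
        ((-1 : ℤ) ^ k * ((n + 1).choose (k + 1) : ℤ)) • (A ^ (n - k) * H k) := by
  induction n with
  | zero => simp
  | succ n ih =>
    have hcomm : ∀ k, H k * A = A * H k - H (k + 1) := fun k => by rw [hH]; abel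
    have hleft : ∑ i ∈ Finset.range (n + 2), A ^ (n + 1 - i) * H 0 * A ^ i =
        A ^ (n + 1) * H 0 + (∑ i ∈ Finset.range (n + 1), A ^ (n - i) * H 0 * A ^ i) * A := by
      rw [Finset.sum_range_succ', Finset.sum_mul, add_comm]
      simp [pow_succ, mul_assoc]
    have hterm : ∀ k ∈ Finset.range (n + 1),
        ((-1 : ℤ) ^ k * ((n + 1).choose (k + 1) : ℤ)) • (A ^ (n - k) * H k) * A =
        ((-1 : ℤ) ^ k * ((n + 1).choose (k + 1) : ℤ)) • (A ^ (n + 1 - k) * H k) +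
        ((-1 : ℤ) ^ (k + 1) * ((n + 1).choose (k + 1) : ℤ)) •
          (A ^ (n + 1 - (k + 1)) * H (k + 1)) := by
      intro k hk
      have hk' : n + 1 - k = (n - k) + 1 := by have := Finset.mem_range.1 hk; omega
      rw [smul_mul_assoc, mul_assoc, hcomm, hk', Nat.add_sub_add_right, mul_sub, pow_succ (A),
        mul_assoc, smul_sub, pow_succ (-1 : ℤ), mul_neg_one, neg_mul, neg_smul, sub_eq_add_neg]
    have hpascal : ∀ k, ((n + 1 + 1).choose (k + 1) : ℤ) =
        ((n + 1).choose k : ℤ) + ((n + 1).choose (k + 1) : ℤ) := fun k => by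
      rw [Nat.choose_succ_succ]; push_cast; rfl
    rw [hleft, ih, Finset.sum_mul, Finset.sum_congr rfl hterm, Finset.sum_add_distrib]
    simp only [hpascal, mul_add, add_smul, Finset.sum_add_distrib]
    rw [Finset.sum_range_succ' (fun k => ((-1 : ℤ) ^ k * ((n + 1).choose k : ℤ)) •
        (A ^ (n + 1 - k) * H k)),
      Finset.sum_range_succ (fun k => ((-1 : ℤ) ^ k * ((n + 1).choose (k + 1) : ℤ)) •
        (A ^ (n + 1 - k) * H k)) (n + 1)]
    simp only [pow_zero, Nat.choose_zero_right, Nat.cast_one, mul_one, one_smul, Nat.sub_zero,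
      Nat.choose_succ_self, Nat.cast_zero, mul_zero, zero_smul, add_zero]
    abel

section BanachAlgebra

variable {𝔸 : Type*} [NormedRing 𝔸] [NormedAlgebra ℂ 𝔸]

/-- The derivative of `A ↦ A ^ (n + 1) / (n + 1)!` in a possibly noncommutative algebra. -/
def expTermDeriv (A : 𝔸) (n : ℕ) : 𝔸 →L[ℂ] 𝔸 :=
  (((n + 1).factorial : ℂ)⁻¹) • ∑ i ∈ Finset.range (n + 1),
    ContinuousLinearMap.mulLeftRight ℂ 𝔸 (A ^ (n - i)) (A ^ i)

lemma expTermDeriv_apply (A : 𝔸) (n : ℕ) (H : 𝔸) :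
    expTermDeriv A n H =
      (((n + 1).factorial : ℂ)⁻¹) • ∑ i ∈ Finset.range (n + 1), A ^ (n - i) * H * A ^ i := by
  simp [expTermDeriv]

lemma hasFDerivAt_exp_term (A : 𝔸) (n : ℕ) :
    HasFDerivAt (fun X : 𝔸 => (((n + 1).factorial : ℂ)⁻¹) • X ^ (n + 1)) (expTermDeriv A n) A := by
  refine ((hasFDerivAt_pow' (𝕜 := ℂ) (n + 1) (x := A)).const_smul
    (((n + 1).factorial : ℂ)⁻¹)).congr_fderiv ?_
  ext H
  simp [expTermDeriv_apply, mul_assoc]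

lemma norm_expTermDeriv_le [NormOneClass 𝔸] {A : 𝔸} {r : ℝ} (hA : ‖A‖ ≤ r) (n : ℕ) :
    ‖expTermDeriv A n‖ ≤ r ^ n / n.factorial := by
  have hterm : ∀ i ∈ Finset.range (n + 1),
      ‖ContinuousLinearMap.mulLeftRight ℂ 𝔸 (A ^ (n - i)) (A ^ i)‖ ≤ r ^ n := by
    intro i hi
    have hi' : n - i + i = n := by have := Finset.mem_range.1 hi; omega
    calc _ ≤ ‖A ^ (n - i)‖ * ‖A ^ i‖ :=
          ContinuousLinearMap.opNorm_mulLeftRight_apply_apply_le ℂ 𝔸 _ _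
      _ ≤ ‖A‖ ^ (n - i) * ‖A‖ ^ i := by gcongr <;> exact norm_pow_le _ _
      _ = ‖A‖ ^ n := by rw [← pow_add, hi']
      _ ≤ r ^ n := by gcongr
  have hsum := norm_sum_le_of_le _ hterm
  rw [Finset.sum_const, Finset.card_range, nsmul_eq_mul] at hsum
  rw [expTermDeriv, norm_smul, norm_inv, Complex.norm_natCast]
  calc _ ≤ (((n + 1).factorial : ℝ))⁻¹ * (((n + 1 : ℕ) : ℝ) * r ^ n) := by gcongr
    _ = r ^ n / n.factorial := by
      rw [Nat.factorial_succ]; push_cast; field_simp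

lemma summable_expTermDeriv [CompleteSpace 𝔸] [NormOneClass 𝔸] (A : 𝔸) : Summable (expTermDeriv A) :=
  Summable.of_norm_bounded (Real.summable_pow_div_factorial ‖A‖)
    (norm_expTermDeriv_le le_rfl)

/-- The exponential series of a Banach algebra is differentiable term by term. -/
lemma hasFDerivAt_exp_series [CompleteSpace 𝔸] [NormOneClass 𝔸] (A : 𝔸) :
    HasFDerivAt (fun X : 𝔸 => ∑' n : ℕ, ((n.factorial : ℂ)⁻¹) • X ^ n)
      (∑' n, expTermDeriv A n) A := by
  have hsplit : (fun X : 𝔸 => ∑' n : ℕ, ((n.factorial : ℂ)⁻¹) • X ^ n) =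
      fun X => 1 + ∑' n : ℕ, (((n + 1).factorial : ℂ)⁻¹) • X ^ (n + 1) := by
    funext X
    rw [(NormedSpace.expSeries_summable' (𝕂 := ℂ) X).tsum_eq_zero_add]
    simp
  rw [hsplit]
  have : NormedSpace ℝ 𝔸 := NormedSpace.restrictScalars ℝ ℂ 𝔸
  refine HasFDerivAt.const_add _ (hasFDerivAt_tsum_of_isPreconnected
    (Real.summable_pow_div_factorial (‖A‖ + 1)) Metric.isOpen_ball
    (convex_ball (0 : 𝔸) (‖A‖ + 1)).isPreconnected (fun n X _ => hasFDerivAt_exp_term X n)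
    (fun n X hX => norm_expTermDeriv_le (mem_ball_zero_iff.1 hX).le n)
    (x₀ := A) (mem_ball_zero_iff.2 (lt_add_one _)) ?_ (mem_ball_zero_iff.2 (lt_add_one _)))
  exact (summable_nat_add_iff 1).2 (NormedSpace.expSeries_summable' (𝕂 := ℂ) A)

/-- The derivative of the exponential series in the direction `H 0` is
`exp A * ∑ (-1)^k H k / (k + 1)!`, where `H k` are the iterated commutators of `A` with `H 0`. -/
lemma tsum_expTermDeriv_apply [CompleteSpace 𝔸] [NormOneClass 𝔸] (A : 𝔸) (H : ℕ → 𝔸)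
    (hH : ∀ k, H (k + 1) = A * H k - H k * A)
    (hs : Summable fun k => ‖((-1 : ℂ) ^ k * ((k + 1).factorial : ℂ)⁻¹) • H k‖) :
    (∑' n, expTermDeriv A n) (H 0) =
      (∑' n : ℕ, ((n.factorial : ℂ)⁻¹) • A ^ n) *
        ∑' k : ℕ, ((-1 : ℂ) ^ k * ((k + 1).factorial : ℂ)⁻¹) • H k := by
  rw [tsum_mul_tsum_eq_tsum_sum_antidiagonal_of_summable_norm
    (NormedSpace.norm_expSeries_summable' (𝕂 := ℂ) A) hs]
  have happ := (ContinuousLinearMap.apply ℂ 𝔸 (H 0)).map_tsum (summable_expTermDeriv A)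
  simp only [ContinuousLinearMap.apply_apply] at happ
  rw [happ]
  refine tsum_congr fun n => ?_
  rw [expTermDeriv_apply, sum_pow_mul_mul_pow_eq A n H hH, Finset.smul_sum,
    ← Finset.Nat.sum_antidiagonal_swap, Finset.Nat.sum_antidiagonal_eq_sum_range_succ_mk]
  refine Finset.sum_congr rfl fun k hk => ?_
  have hk' : k ≤ n := Nat.lt_succ_iff.1 (Finset.mem_range.1 hk)
  have hfac : ((n + 1).factorial : ℂ)⁻¹ * ((-1 : ℂ) ^ k * ((n + 1).choose (k + 1) : ℂ)) =
      ((n - k).factorial : ℂ)⁻¹ * ((-1 : ℂ) ^ k * ((k + 1).factorial : ℂ)⁻¹) := by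
    have hc := Nat.choose_mul_factorial_mul_factorial (Nat.succ_le_succ hk')
    rw [Nat.succ_sub_succ] at hc
    have hc' : ((n + 1).choose (k + 1) : ℂ) * (k + 1).factorial * (n - k).factorial =
      (n + 1).factorial := by exact_mod_cast hc
    have h1 : ((n + 1).factorial : ℂ) ≠ 0 := by exact_mod_cast Nat.factorial_ne_zero _
    have h2 : ((k + 1).factorial : ℂ) ≠ 0 := by exact_mod_cast Nat.factorial_ne_zero _
    have h3 : ((n - k).factorial : ℂ) ≠ 0 := by exact_mod_cast Nat.factorial_ne_zero _
    field_simp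
    linear_combination hc'
  rw [← Int.cast_smul_eq_zsmul ℂ, smul_smul]
  push_cast
  rw [hfac, Prod.swap_prod_mk, smul_mul_smul_comm]

end BanachAlgebra

lemma tsum_eq_tsum_even {E : Type*} [AddCommMonoid E] [TopologicalSpace E] (f : ℕ → E)
    (hf : ∀ n, f (2 * n + 1) = 0) : ∑' n, f n = ∑' n, f (2 * n) := by
  refine ((mul_right_injective₀ (two_ne_zero' ℕ)).tsum_eq ?_).symm
  intro n hn
  rcases Nat.even_or_odd' n with ⟨j, rfl | rfl⟩
  · exact ⟨j, rfl⟩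
  · exact absurd (hf j) hn

/-- The map `Z ↦ ad_Z`, as a continuous linear map. -/
def adCLM (bra : L →ₗ[ℂ] L →ₗ[ℂ] L) : L →L[ℂ] (L →L[ℂ] L) :=
  LinearMap.toContinuousLinearMap
    ((LinearMap.toContinuousLinearMap : (L →ₗ[ℂ] L) ≃ₗ[ℂ] (L →L[ℂ] L)).toLinearMap ∘ₗ bra)

lemma adC_apply (bra : L →ₗ[ℂ] L →ₗ[ℂ] L) (Z W : L) : adC bra Z W = bra Z W := rfl

lemma adC_pow_succ_apply (bra : L →ₗ[ℂ] L →ₗ[ℂ] L) (Z W : L) (n : ℕ) :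
    (adC bra Z ^ (n + 1)) W = bra Z ((adC bra Z ^ n) W) := by
  rw [pow_succ']; rfl

lemma summable_factorial_smul_pow (T : L →L[ℂ] L) :
    Summable fun n : ℕ => ((n.factorial : ℂ)⁻¹) • T ^ n :=
  have := FiniteDimensional.complete ℂ L
  NormedSpace.expSeries_summable' T

lemma norm_factorial_succ_smul_pow_le {V : Type*} [NormedAddCommGroup V]
    [NormedSpace ℂ V] (T : V →L[ℂ] V) (n : ℕ) :
    ‖((-1 : ℂ) ^ n * ((n + 1).factorial : ℂ)⁻¹) • T ^ n‖ ≤ ‖((n.factorial : ℂ)⁻¹) • T ^ n‖ := by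
  rw [norm_smul, norm_smul, norm_mul, norm_pow, norm_neg, norm_one, one_pow, one_mul, norm_inv,
    norm_inv, Complex.norm_natCast, Complex.norm_natCast]
  have h : (n.factorial : ℝ) ≤ (n + 1).factorial := by
    exact_mod_cast Nat.factorial_le (Nat.le_succ n)
  have h0 : (0 : ℝ) < n.factorial := by exact_mod_cast Nat.factorial_pos n
  gcongr

lemma summable_norm_factorial_succ_smul_pow {V : Type*} [NormedAddCommGroup V]
    [NormedSpace ℂ V] (T : V →L[ℂ] V) :
    Summable fun n : ℕ => ‖((-1 : ℂ) ^ n * ((n + 1).factorial : ℂ)⁻¹) • T ^ n‖ :=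
  Summable.of_nonneg_of_le (fun _ => norm_nonneg _) (norm_factorial_succ_smul_pow_le T)
    (NormedSpace.norm_expSeries_summable' (𝕂 := ℂ) T)

lemma hasSum_expOp_apply (T : L →L[ℂ] L) (W : L) :
    HasSum (fun n : ℕ => ((n.factorial : ℂ)⁻¹) • (T ^ n) W) (expOp T W) :=
  (summable_factorial_smul_pow T).hasSum.mapL (ContinuousLinearMap.apply ℂ L W)

lemma Sop_apply (bra : L →ₗ[ℂ] L →ₗ[ℂ] L) (Z W : L) :
    Sop bra Z W = ∑' n : ℕ, (((2 * n).factorial : ℂ)⁻¹) • (adC bra Z ^ (2 * n)) W :=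
  have := FiniteDimensional.complete ℂ L
  (ContinuousLinearMap.apply ℂ L W).map_tsum
    ((summable_factorial_smul_pow (adC bra Z)).comp_injective
      (mul_right_injective₀ (two_ne_zero' ℕ)))

lemma summable_Eop (bra : L →ₗ[ℂ] L →ₗ[ℂ] L) (Z : L) :
    Summable fun n : ℕ => (((2 * n + 1).factorial : ℂ)⁻¹) • adC bra Z ^ (2 * n) := by
  have := FiniteDimensional.complete ℂ L
  refine ((summable_norm_factorial_succ_smul_pow (adC bra Z)).of_norm.comp_injective
    (mul_right_injective₀ (two_ne_zero' ℕ))).congr fun n => ?_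
  simp [pow_mul]

lemma hasSum_Eop_apply (bra : L →ₗ[ℂ] L →ₗ[ℂ] L) (Z B : L) :
    HasSum (fun n : ℕ => (((2 * n + 1).factorial : ℂ)⁻¹) • (adC bra Z ^ (2 * n)) B)
      (Eop bra Z B) :=
  (summable_Eop bra Z).hasSum.mapL (ContinuousLinearMap.apply ℂ L B)

lemma hasFDerivAt_bra_expOp [Nontrivial L] (bra : L →ₗ[ℂ] L →ₗ[ℂ] L) (Υ Z : L) :
    HasFDerivAt (fun Z' : L => bra Υ (expOp (adC bra Z') Υ))
      ((adC bra Υ).comp ((ContinuousLinearMap.apply ℂ L Υ).comp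
        ((∑' n, expTermDeriv (adC bra Z) n).comp (adCLM bra)))) Z := by
  have := FiniteDimensional.complete ℂ L
  have hexp : HasFDerivAt (fun Z' : L => expOp (adC bra Z'))
      ((∑' n, expTermDeriv (adC bra Z) n).comp (adCLM bra)) Z :=
    (hasFDerivAt_exp_series (adC bra Z)).comp Z (adCLM bra).hasFDerivAt
  exact (adC bra Υ).hasFDerivAt.comp Z
    ((ContinuousLinearMap.apply ℂ L Υ).hasFDerivAt.comp Z hexp)

/-- The derivative of the exponential at `ad_Z` in the direction `ad_B`. -/
lemma tsum_expTermDeriv_adC_apply [Nontrivial L] (bra : L →ₗ[ℂ] L →ₗ[ℂ] L)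
    (hjac : ∀ x y z : L, bra x (bra y z) = bra (bra x y) z + bra y (bra x z)) (Z B W : L) :
    (∑' n, expTermDeriv (adC bra Z) n) (adC bra B) W =
      expOp (adC bra Z) (∑' k : ℕ, ((-1 : ℂ) ^ k * ((k + 1).factorial : ℂ)⁻¹) •
        bra ((adC bra Z ^ k) B) W) := by
  have := FiniteDimensional.complete ℂ L
  set Φ : (L →L[ℂ] L) →L[ℂ] (L →L[ℂ] L) :=
    (adCLM bra).comp (ContinuousLinearMap.apply ℂ L B)
  have hs : Summable fun k : ℕ => ‖((-1 : ℂ) ^ k * ((k + 1).factorial : ℂ)⁻¹) •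
      adC bra ((adC bra Z ^ k) B)‖ := by
    refine Summable.of_nonneg_of_le (fun _ => norm_nonneg _) (fun k => ?_)
      ((summable_norm_factorial_succ_smul_pow (adC bra Z)).mul_left ‖Φ‖)
    have h := Φ.le_opNorm (((-1 : ℂ) ^ k * ((k + 1).factorial : ℂ)⁻¹) • adC bra Z ^ k)
    rwa [map_smul] at h
  have hH : ∀ k, adC bra ((adC bra Z ^ (k + 1)) B) =
      adC bra Z * adC bra ((adC bra Z ^ k) B) - adC bra ((adC bra Z ^ k) B) * adC bra Z := by
    intro k
    ext Y
    rw [adC_pow_succ_apply]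
    exact eq_sub_of_add_eq (hjac Z _ Y).symm
  have h := tsum_expTermDeriv_apply (adC bra Z) (fun k => adC bra ((adC bra Z ^ k) B)) hH hs
  have hW := congrArg (fun T : L →L[ℂ] L => T W) h
  refine hW.trans (congrArg (expOp (adC bra Z)) ?_)
  exact (ContinuousLinearMap.apply ℂ L W).map_tsum hs.of_norm

/-- P : m → m is ℂ-differentiable at every point of m, with Fréchet derivative at Z (within m) the ℂ-linear map B ↦ S_{JZ}(E_Z(B)). -/
theorem statement11 {L : Type*} [NormedAddCommGroup L] [NormedSpace ℂ L] [FiniteDimensional ℂ L]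
    (bra : L →ₗ[ℂ] L →ₗ[ℂ] L)
    (halt : ∀ x : L, bra x x = 0)
    (hjac : ∀ x y z : L, bra x (bra y z) = bra (bra x y) z + bra y (bra x z))
    (k mp mn : Submodule ℂ L)
    (hsup : k ⊔ (mp ⊔ mn) = ⊤)
    (hd1 : Disjoint k (mp ⊔ mn))
    (hd2 : Disjoint mp mn)
    (hkk : ∀ x ∈ k, ∀ y ∈ k, bra x y ∈ k)
    (hkp : ∀ x ∈ k, ∀ y ∈ mp, bra x y ∈ mp)
    (hkn : ∀ x ∈ k, ∀ y ∈ mn, bra x y ∈ mn)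
    (hpp : ∀ x ∈ mp, ∀ y ∈ mp, bra x y = 0)
    (hnn : ∀ x ∈ mn, ∀ y ∈ mn, bra x y = 0)
    (hpn : ∀ x ∈ mp, ∀ y ∈ mn, bra x y ∈ k)
    (J : L →ₗ[ℂ] L)
    (hJp : ∀ x ∈ mp, J x = Complex.I • x)
    (hJn : ∀ x ∈ mn, J x = -(Complex.I • x))
    (Υ : L)
    (hUk : ∀ X ∈ k, bra Υ X = 0)
    (hUm : ∀ W ∈ mp ⊔ mn, bra Υ W = J W)
    (Z : L) (hZ : Z ∈ mp ⊔ mn) :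
    HasFDerivWithinAt (fun Z' : L => bra Υ (expOp (adC bra Z') Υ))
      ((Sop bra (J Z)).comp (Eop bra Z)) ((mp ⊔ mn : Submodule ℂ L) : Set L) Z := by
  set m : Submodule ℂ L := mp ⊔ mn
  have hskew : ∀ x y, bra x y = -bra y x := fun x y => by
    have h := halt (x + y)
    simp only [map_add, LinearMap.add_apply, halt, zero_add, add_zero] at h
    exact eq_neg_of_add_eq_zero_right h
  have hJm : ∀ W ∈ m, J W ∈ m ∧ J (J W) = -W := by
    intro W hW
    obtain ⟨p, hp, q, hq, rfl⟩ := Submodule.mem_sup.1 hW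
    have hJ : J (p + q) = Complex.I • p + -(Complex.I • q) := by
      rw [map_add, hJp p hp, hJn q hq]
    refine ⟨hJ ▸ Submodule.add_mem_sup (mp.smul_mem _ hp) (mn.neg_mem (mn.smul_mem _ hq)), ?_⟩
    rw [hJ, map_add, map_neg, map_smul, map_smul, hJp p hp, hJn q hq, smul_neg, smul_smul,
      smul_smul, Complex.I_mul_I]
    module
  have hmm : ∀ X ∈ m, ∀ Y ∈ m, bra X Y ∈ k := by
    intro X hX Y hY
    obtain ⟨p, hp, q, hq, rfl⟩ := Submodule.mem_sup.1 hX
    obtain ⟨p', hp', q', hq', rfl⟩ := Submodule.mem_sup.1 hY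
    simp only [map_add, LinearMap.add_apply, hpp p hp p' hp', hnn q hq q' hq', zero_add, add_zero]
    rw [hskew q p']
    exact k.add_mem (k.neg_mem (hpn _ hp' _ hq)) (hpn _ hp _ hq')
  have hmk : ∀ X ∈ m, ∀ κ ∈ k, bra X κ ∈ m := by
    intro X hX κ hκ
    obtain ⟨p, hp, q, hq, rfl⟩ := Submodule.mem_sup.1 hX
    rw [hskew, map_add]
    exact m.neg_mem (Submodule.add_mem_sup (hkp κ hκ p hp) (hkn κ hκ q hq))
  have hpow : ∀ X ∈ m, ∀ W ∈ m, ∀ n : ℕ, (adC bra X ^ (2 * n)) W ∈ m := by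
    intro X hX W hW n
    induction n with
    | zero => simpa using hW
    | succ n ih =>
      rw [Nat.mul_succ, adC_pow_succ_apply, adC_pow_succ_apply]
      exact hmk X hX _ (hmm X hX _ ih)
  have hpow' : ∀ X ∈ m, ∀ W ∈ m, ∀ n : ℕ, (adC bra X ^ (2 * n + 1)) W ∈ k := by
    intro X hX W hW n
    rw [adC_pow_succ_apply]
    exact hmm X hX _ (hpow X hX W hW n)
  have hUbra : ∀ X ∈ m, ∀ κ ∈ k, bra (J X) κ = J (bra X κ) := by
    intro X hX κ hκ
    rw [← hUm _ (hmk X hX κ hκ), hjac, hUm X hX, hUk κ hκ, map_zero, add_zero]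
  have hJbra : ∀ X ∈ m, ∀ Y ∈ m, bra (J X) Y = -bra X (J Y) := by
    intro X hX Y hY
    have h := hjac Υ X Y
    rw [hUk _ (hmm X hX Y hY), hUm X hX, hUm Y hY] at h
    exact eq_neg_of_add_eq_zero_left h.symm
  have hconj : ∀ W ∈ m, ∀ n : ℕ,
      (adC bra (J Z) ^ (2 * n)) W = -J ((adC bra Z ^ (2 * n)) (J W)) := by
    intro W hW n
    induction n with
    | zero => simp [(hJm W hW).2]
    | succ n ih =>
      have hV := hpow Z hZ (J W) (hJm W hW).1 n
      rw [Nat.mul_succ, adC_pow_succ_apply, adC_pow_succ_apply, adC_pow_succ_apply,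
        adC_pow_succ_apply, ih, hJbra Z hZ _ (m.neg_mem (hJm _ hV).1), map_neg J, (hJm _ hV).2,
        neg_neg, map_neg, hUbra Z hZ _ (hmm Z hZ _ hV)]
  have hE : ∀ B ∈ m, Eop bra Z B ∈ m := by
    intro B hB
    exact (Submodule.closed_of_finiteDimensional m).mem_of_tendsto (hasSum_Eop_apply bra Z B)
      (Filter.Eventually.of_forall fun s =>
        m.sum_mem fun n _ => m.smul_mem _ (hpow Z hZ B hB n))
  have hright : ∀ B ∈ m, ∑' j : ℕ, ((-1 : ℂ) ^ j * ((j + 1).factorial : ℂ)⁻¹) •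
      bra ((adC bra Z ^ j) B) Υ = -J (Eop bra Z B) := by
    intro B hB
    rw [tsum_eq_tsum_even _ fun n => by
      rw [hskew, hUk _ (hpow' Z hZ B hB n), neg_zero, smul_zero]]
    rw [← hUm _ (hE B hB), ← adC_apply bra Υ (Eop bra Z B)]
    refine HasSum.tsum_eq (((hasSum_Eop_apply bra Z B).mapL (adC bra Υ)).neg.congr_fun ?_)
    intro n
    rw [hskew, smul_neg, map_smul, adC_apply, pow_mul, neg_one_sq, one_pow, one_mul]
  have hleft : ∀ V ∈ m, bra Υ (expOp (adC bra Z) (-J V)) = Sop bra (J Z) V := by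
    intro V hV
    have hW := m.neg_mem (hJm V hV).1
    rw [← adC_apply, ← ((hasSum_expOp_apply (adC bra Z) (-J V)).mapL (adC bra Υ)).tsum_eq,
      Sop_apply,
      tsum_eq_tsum_even _ fun n => by
        rw [map_smul, adC_apply, hUk _ (hpow' Z hZ _ hW n), smul_zero]]
    refine tsum_congr fun n => ?_
    rw [map_smul, adC_apply, hUm _ (hpow Z hZ _ hW n), hconj V hV, map_neg, map_neg]
  rcases subsingleton_or_nontrivial L with hL | hL
  · exact (hasFDerivAt_of_subsingleton _ Z).hasFDerivWithinAt.congr_fderiv (Subsingleton.elim _ _)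
  refine HasFDerivWithinAt.of_isLittleO
    ((hasFDerivAt_bra_expOp bra Υ Z).hasFDerivWithinAt.isLittleO.congr' ?_ Filter.EventuallyEq.rfl)
  filter_upwards [self_mem_nhdsWithin] with Z' hZ'
  have hB : Z' - Z ∈ m := m.sub_mem hZ' hZ
  refine congrArg _ ?_
  change bra Υ ((∑' n, expTermDeriv (adC bra Z) n) (adC bra (Z' - Z)) Υ) =
    Sop bra (J Z) (Eop bra Z (Z' - Z))
  rw [tsum_expTermDeriv_adC_apply bra hjac, hright _ hB, hleft _ (hE _ hB)]
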